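/- arXiv:1908.04295 — 7 statements merged into one kernel-verified Lean document; each statement's English description precedes it below -/
import Mathlib

section
/- Let p > 0 and ε > 0. If each member of a set S of participants contributes at least ε units of currency and receives a token fraction of at least p times her contribution, and the token fractions of all participants sum to at most 1, then S is finite and has cardinality at most 1/(p·ε). In particular, it is impossible for infinitely many such participants to all take part. -/
/-- If every participant in `S` contributes at least `ε > 0`, receives a token
fraction at least `p` times her contribution, and the fractions over any finite
collection of participants sum to at most 1, then `S` is finite with at most
`1/(p·ε)` members: infinitely many participants cannot all take part. -/
theorem crowdsale_participation_bound {ι : Type*} (p ε : ℝ) (hp : 0 < p) (hε : 0 < ε)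
    (S : Set ι) (c f : ι → ℝ)
    (hc : ∀ i ∈ S, ε ≤ c i)
    (hpc : ∀ i ∈ S, f i ≥ p * c i)
    (hsum : ∀ t : Finset ι, ↑t ⊆ S → ∑ i ∈ t, f i ≤ 1) :
    S.Finite ∧ (S.ncard : ℝ) ≤ 1 / (p * ε) := by
  have card_le : ∀ t : Finset ι, ↑t ⊆ S → (t.card : ℝ) ≤ 1 / (p * ε) := by
    intro t ht
    rw [le_div_iff₀ (mul_pos hp hε), ← nsmul_eq_mul]
    refine (t.card_nsmul_le_sum f (p * ε) fun i hi ↦ ?_).trans (hsum t ht)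
    exact (mul_le_mul_of_nonneg_left (hc i (ht hi)) hp.le).trans (hpc i (ht hi))
  have hfin : S.Finite := by
    by_contra hinf
    obtain ⟨n, hn⟩ := exists_nat_gt (1 / (p * ε))
    obtain ⟨t, htS, rfl⟩ := Set.Infinite.exists_subset_card_eq hinf n
    exact hn.not_ge (card_le t htS)
  refine ⟨hfin, ?_⟩
  rw [Set.ncard_eq_toFinset_card S hfin]
  exact card_le hfin.toFinset hfin.coe_toFinset.subset
end

section
/- For every finite family of bids, where bid i has value v_i > 0 and personal cap c_i > 0, there exists a real number V ≥ 0 such that Σ_{i : c_i > V} v_i ≤ V ≤ Σ_{i : c_i ≥ V} v_i. -/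
open Finset

/-- Existence of a clearing valuation: for any finite family of bids with
values `v i > 0` and personal caps `c i > 0`, there is `V ≥ 0` with
`Σ_{c i > V} v i ≤ V ≤ Σ_{c i ≥ V} v i`. -/
theorem clearing_valuation_exists {ι : Type*} [Fintype ι] (v c : ι → ℝ)
    (hv : ∀ i, 0 < v i) (hc : ∀ i, 0 < c i) :
    ∃ V : ℝ, 0 ≤ V ∧
      (∑ i ∈ univ.filter (fun i => c i > V), v i) ≤ V ∧
      V ≤ ∑ i ∈ univ.filter (fun i => c i ≥ V), v i := by
  classical
  obtain ⟨A, -, hA⟩ := exists_max_image (univ : Finset (Finset ι))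
    (fun A => A.fold min (∑ i ∈ A, v i) c) univ_nonempty
  set V := A.fold min (∑ i ∈ A, v i) c with hV
  obtain ⟨hVsum, hVcap⟩ := (le_fold_min V).1 hV.le
  refine ⟨V, ?_, ?_, ?_⟩
  · exact (le_fold_min 0).2 ⟨sum_nonneg fun i _ => (hv i).le, fun i _ => (hc i).le⟩
  · by_contra! h
    refine (hA (univ.filter fun i => c i > V) (mem_univ _)).not_gt ?_
    exact (lt_fold_min V).2 ⟨h, fun i hi => (mem_filter.1 hi).2⟩
  · refine hVsum.trans (sum_le_sum_of_subset_of_nonneg (fun i hi => ?_) fun i _ _ => (hv i).le)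
    exact mem_filter.2 ⟨mem_univ i, hVcap i hi⟩
end

section
/- For every finite family of bids, where bid i has value v_i > 0 and personal cap c_i > 0, the clearing valuation is unique: if V₁ ≥ 0 and V₂ ≥ 0 both satisfy Σ_{i : c_i > V} v_i ≤ V ≤ Σ_{i : c_i ≥ V} v_i, then V₁ = V₂. -/
open Finset

/-- If the bids with cap at least `W` cover `W`, and the bids with cap exceeding `V` total at most
`V`, then `W ≤ V`. -/
theorem le_of_le_sum_of_sum_le {ι : Type*} [Fintype ι] {v c : ι → ℝ} (hv : ∀ i, 0 ≤ v i) {V W : ℝ}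
    (hV : (∑ i ∈ univ.filter (fun i => c i > V), v i) ≤ V)
    (hW : W ≤ ∑ i ∈ univ.filter (fun i => c i ≥ W), v i) : W ≤ V := by
  by_contra! h
  have hsub : univ.filter (fun i => c i ≥ W) ⊆ univ.filter (fun i => c i > V) :=
    monotone_filter_right _ fun _ _ hi => h.trans_le hi
  exact h.not_ge (hW.trans ((sum_le_sum_of_subset_of_nonneg hsub fun i _ _ => hv i).trans hV))

/-- Uniqueness of the clearing valuation: if `V₁, V₂ ≥ 0` both satisfy
`Σ_{c i > V} v i ≤ V ≤ Σ_{c i ≥ V} v i`, then `V₁ = V₂`. -/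
theorem clearing_valuation_unique {ι : Type*} [Fintype ι] (v c : ι → ℝ)
    (hv : ∀ i, 0 < v i) (hc : ∀ i, 0 < c i) (V₁ V₂ : ℝ)
    (hV₁0 : 0 ≤ V₁) (hV₂0 : 0 ≤ V₂)
    (h₁l : (∑ i ∈ univ.filter (fun i => c i > V₁), v i) ≤ V₁)
    (h₁r : V₁ ≤ ∑ i ∈ univ.filter (fun i => c i ≥ V₁), v i)
    (h₂l : (∑ i ∈ univ.filter (fun i => c i > V₂), v i) ≤ V₂)
    (h₂r : V₂ ≤ ∑ i ∈ univ.filter (fun i => c i ≥ V₂), v i) :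
    V₁ = V₂ := by
  have hv' : ∀ i, 0 ≤ v i := fun i => (hv i).le
  exact le_antisymm (le_of_le_sum_of_sum_le hv' h₂l h₁r) (le_of_le_sum_of_sum_le hv' h₁l h₂r)
end

section
/- Let V ≥ 0 be the clearing valuation of a finite family of bids with values v_i > 0 and personal caps c_i > 0, and suppose a new bid with value v > 0 and personal cap c > V is added to the family. Then any clearing valuation V′ of the enlarged family satisfies V′ ≥ V. -/
open Finset

/-- Monotone valuation invariant: if `V` is a clearing valuation of a finite
family of bids and a new bid with value `v₀ > 0` and personal cap `c₀ > V` is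
added, then any clearing valuation `V'` of the enlarged family satisfies
`V' ≥ V`. -/
theorem clearing_valuation_monotone {ι : Type*} [Fintype ι] (v c : ι → ℝ)
    (hv : ∀ i, 0 < v i) (hc : ∀ i, 0 < c i) (V : ℝ) (hV0 : 0 ≤ V)
    (hl : (∑ i ∈ univ.filter (fun i => c i > V), v i) ≤ V)
    (hr : V ≤ ∑ i ∈ univ.filter (fun i => c i ≥ V), v i)
    (v₀ c₀ : ℝ) (hv₀ : 0 < v₀) (hc₀ : c₀ > V)
    (v' c' : ι ⊕ Unit → ℝ)
    (hv' : v' = Sum.elim v (fun _ => v₀)) (hc' : c' = Sum.elim c (fun _ => c₀))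
    (V' : ℝ) (hV'0 : 0 ≤ V')
    (hl' : (∑ i ∈ univ.filter (fun i => c' i > V'), v' i) ≤ V')
    (hr' : V' ≤ ∑ i ∈ univ.filter (fun i => c' i ≥ V'), v' i) :
    V' ≥ V := by
  subst hv' hc'
  by_contra! hlt
  refine hlt.not_ge (hr.trans (le_trans ?_ hl'))
  calc ∑ i ∈ univ.filter (fun i => c i ≥ V), v i
      = ∑ i ∈ (univ.filter (fun i => c i ≥ V)).map .inl, Sum.elim v (fun _ => v₀) i := by
        simp
    _ ≤ _ := by
        refine sum_le_sum_of_subset_of_nonneg (fun i hi => ?_) fun i _ _ => ?_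
        · obtain ⟨j, hj, rfl⟩ := mem_map.1 hi
          exact mem_filter.2 ⟨mem_univ _, hlt.trans_le (mem_filter.1 hj).2⟩
        · cases i
          exacts [(hv _).le, hv₀.le]
end

section
/- For all real numbers A ≥ B > 0 and 0 < x ≤ y, the adversary's advantage satisfies Ax/(Ax + By) − Ax/(Ax + Ay) ≤ (A − B)/(A + 2B). -/
/-- Blackout attack bound, case `x ≤ y`:
`Ax/(Ax+By) − Ax/(Ax+Ay) ≤ (A−B)/(A+2B)`. -/
theorem blackout_advantage_bound_xley (A B x y : ℝ)
    (hAB : A ≥ B) (hB : 0 < B) (hx : 0 < x) (hxy : x ≤ y) :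
    A * x / (A * x + B * y) - A * x / (A * x + A * y) ≤ (A - B) / (A + 2 * B) := by
  have hA : 0 < A := hB.trans_le hAB
  have hy : 0 < y := hx.trans_le hxy
  have advantage_eq : A * x / (A * x + B * y) - A * x / (A * x + A * y)
      = (A - B) * (x * y) / ((A * x + B * y) * (x + y)) := by
    have h₁ : A * x + B * y ≠ 0 := by positivity
    have h₂ : x + y ≠ 0 := by positivity
    rw [← mul_add, mul_div_mul_left _ _ hA.ne', div_sub_div _ _ h₁ h₂]
    ring
  rw [advantage_eq, div_le_div_iff₀ (by positivity) (by positivity), mul_assoc]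
  refine mul_le_mul_of_nonneg_left ?_ (sub_nonneg.2 hAB)
  have hBy : B * y * x ≤ B * y * y := by gcongr
  have hAx : 0 ≤ A * x ^ 2 := by positivity
  linarith
end

section
/- For all real numbers A ≥ B > 0 and x ≥ y > 0, the adversary's advantage satisfies Ax/(Ax + By) − Ax/(Ax + Ay) ≤ (A − B)/(2A + B). -/
/-- Blackout attack bound, case `x ≥ y`:
`Ax/(Ax+By) − Ax/(Ax+Ay) ≤ (A−B)/(2A+B)`. -/
theorem blackout_advantage_bound_xgey (A B x y : ℝ)
    (hAB : A ≥ B) (hB : 0 < B) (hy : 0 < y) (hxy : x ≥ y) :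
    A * x / (A * x + B * y) - A * x / (A * x + A * y) ≤ (A - B) / (2 * A + B) := by
  have hA : 0 < A := hB.trans_le hAB
  have hx : 0 < x := hy.trans_le hxy
  have advantage_eq : A * x / (A * x + B * y) - A * x / (A * x + A * y)
      = (A - B) * (x * y) / ((A * x + B * y) * (x + y)) := by
    have h₁ : A * x + B * y ≠ 0 := by positivity
    have h₂ : x + y ≠ 0 := by positivity
    rw [← mul_add, mul_div_mul_left _ _ hA.ne', div_sub_div _ _ h₁ h₂]
    ring
  have key : x * y * (2 * A + B) ≤ (A * x + B * y) * (x + y) := by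
    have h₁ : 0 ≤ A * x * (x - y) := mul_nonneg (by positivity) (sub_nonneg.2 hxy)
    have h₂ : 0 ≤ B * y ^ 2 := by positivity
    linarith
  rw [advantage_eq, div_le_div_iff₀ (by positivity) (by positivity), mul_assoc]
  exact mul_le_mul_of_nonneg_left key (sub_nonneg.2 hAB)
end

section
/- Let 0 ≤ b ≤ a, set A = 1 + a and B = 1 + b, and let x, y > 0. Then the adversary's advantage satisfies Ax/(Ax + By) − Ax/(Ax + Ay) ≤ (a − b)/3. -/
/-- The adversary's blackout-attack advantage is at most `(a − b)/3`, where
`A = 1 + a` and `B = 1 + b` with `0 ≤ b ≤ a`. -/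
theorem blackout_advantage_le_third (a b x y : ℝ)
    (hb : 0 ≤ b) (hba : b ≤ a) (hx : 0 < x) (hy : 0 < y) :
    (1 + a) * x / ((1 + a) * x + (1 + b) * y) -
      (1 + a) * x / ((1 + a) * x + (1 + a) * y) ≤ (a - b) / 3 := by
  have hA : 0 < 1 + a := by linarith
  have hB : 0 < 1 + b := by linarith
  have hD : 0 < (1 + a) * x + (1 + b) * y := by positivity
  have advantage_eq : (1 + a) * x / ((1 + a) * x + (1 + b) * y) -
      (1 + a) * x / ((1 + a) * x + (1 + a) * y) =
        (a - b) * (x * y / (((1 + a) * x + (1 + b) * y) * (x + y))) := by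
    rw [← mul_add, mul_div_mul_left _ _ hA.ne']
    field_simp
    ring
  have hfrac : x * y / (((1 + a) * x + (1 + b) * y) * (x + y)) ≤ 1 / 3 := by
    rw [div_le_div_iff₀ (by positivity) (by norm_num)]
    have hsum : x + y ≤ (1 + a) * x + (1 + b) * y := by
      nlinarith [mul_nonneg (hb.trans hba) hx.le, mul_nonneg hb hy.le]
    nlinarith [mul_le_mul_of_nonneg_right hsum (add_pos hx hy).le, sq_nonneg (x - y),
      mul_pos hx hy]
  rw [advantage_eq, div_eq_mul_one_div (a - b)]
  exact mul_le_mul_of_nonneg_left hfrac (sub_nonneg.mpr hba)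
end
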